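/- arXiv:cond-mat/9511019 — 2 statements merged into one kernel-verified Lean document; each statement's English description precedes it below -/
import Mathlib

section
/- Let p = 2N+1 be an odd squarefree integer with p ≡ 3 (mod 4), and let χ be the Jacobi symbol mod p. Let J be the N×N matrix with entries J_{k,x} = (2/√p)·sin(2πkx/p) for 1 ≤ k,x ≤ N, and let ψ ∈ ℝ^N be the vector with components ψ_x = χ(x). Then Jψ = ψ. -/
open Finset Complex

/-- The Gaussian binomial coefficient, defined by the `q`-Pascal rule. -/
def gaussBinom {R : Type*} [CommRing R] (q : R) : ℕ → ℕ → R
  | _, 0 => 1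
  | 0, _ + 1 => 0
  | m + 1, j + 1 => gaussBinom q m j + q ^ (j + 1) * gaussBinom q m (j + 1)

namespace gaussBinom

variable {R : Type*} [CommRing R] (q : R)

@[simp] lemma zero_right (m : ℕ) : gaussBinom q m 0 = 1 := by cases m <;> rfl

@[simp] lemma zero_left (j : ℕ) : gaussBinom q 0 (j + 1) = 0 := rfl

lemma succ_succ (m j : ℕ) :
    gaussBinom q (m + 1) (j + 1) = gaussBinom q m j + q ^ (j + 1) * gaussBinom q m (j + 1) := rfl

lemma eq_zero_of_lt {m j : ℕ} (h : m < j) : gaussBinom q m j = 0 := by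
  induction m generalizing j with
  | zero => obtain ⟨j, rfl⟩ := Nat.exists_eq_succ_of_ne_zero h.ne'; rfl
  | succ m ih =>
    obtain ⟨j, rfl⟩ := Nat.exists_eq_succ_of_ne_zero (Nat.ne_zero_of_lt h)
    rw [Nat.succ_eq_add_one, succ_succ, ih (by omega), ih (by omega)]
    ring

lemma one_sub_pow_mul (m j : ℕ) :
    (1 - q ^ (j + 1)) * gaussBinom q (m + 1) (j + 1) = (1 - q ^ (m + 1)) * gaussBinom q m j := by
  induction m generalizing j with
  | zero => cases j <;> simp [succ_succ]
  | succ m ih =>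
    rw [succ_succ q (m + 1) j]
    cases j with
    | zero =>
      have := ih 0
      simp only [zero_right] at this ⊢
      linear_combination q * this
    | succ j =>
      have h₁ := ih (j + 1)
      have h₂ := ih j
      have h₃ := succ_succ q m j
      linear_combination q ^ (j + 2) * h₁ + q * h₂ - q * (1 - q ^ (m + 1)) * h₃

lemma pow_mul_succ_succ (m j : ℕ) :
    q ^ (j + 1) * gaussBinom q (m + 1) (j + 1) =
      q ^ (m + 1) * gaussBinom q m j + q ^ (j + 1) * gaussBinom q m (j + 1) := by
  linear_combination succ_succ q m j - one_sub_pow_mul q m j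

/-- Gauss's recursion for the alternating sum of Gaussian binomial coefficients. -/
lemma alternating_sum_add_two (m : ℕ) :
    ∑ j ∈ range (m + 3), (-1) ^ j * gaussBinom q (m + 2) j =
      (1 - q ^ (m + 1)) * ∑ j ∈ range (m + 1), (-1) ^ j * gaussBinom q m j := by
  have tail (l : ℕ) (w : ℕ → R) :
      ∑ j ∈ range (l + 1), w (j + 1) * gaussBinom q l (j + 1) =
        (∑ j ∈ range (l + 1), w j * gaussBinom q l j) - w 0 := by
    have := sum_range_succ' (fun j ↦ w j * gaussBinom q l j) (l + 1)
    rw [sum_range_succ, eq_zero_of_lt q (Nat.lt_succ_self l)] at this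
    simp only [zero_right] at this
    linear_combination -this
  have hf (l : ℕ) : ∑ j ∈ range (l + 2), (-1) ^ j * gaussBinom q (l + 1) j =
      -∑ j ∈ range (l + 1), (-1) ^ j * gaussBinom q l j +
        ∑ j ∈ range (l + 1), (-1) ^ j * q ^ j * gaussBinom q l j := by
    have h := tail l fun j ↦ (-1) ^ j * q ^ j
    rw [sum_range_succ', eq_add_of_sub_eq h.symm, ← sum_neg_distrib, ← add_assoc,
      ← sum_add_distrib]
    simp only [zero_right, pow_zero]
    congr 1
    · exact sum_congr rfl fun j _ ↦ by rw [succ_succ]; ring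
  have hg : ∑ j ∈ range (m + 2), (-1) ^ j * q ^ j * gaussBinom q (m + 1) j =
      -q ^ (m + 1) * ∑ j ∈ range (m + 1), (-1) ^ j * gaussBinom q m j +
        ∑ j ∈ range (m + 1), (-1) ^ j * q ^ j * gaussBinom q m j := by
    have h := tail m fun j ↦ (-1) ^ j * q ^ j
    rw [sum_range_succ', eq_add_of_sub_eq h.symm, mul_sum, ← add_assoc, ← sum_add_distrib]
    simp only [zero_right, pow_zero, mul_one]
    congr 1
    · exact sum_congr rfl fun j _ ↦ by
        linear_combination (-1) ^ (j + 1) * pow_mul_succ_succ q m j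
  rw [hf (m + 1), hg, hf m]
  ring

/-- Gauss's product formula for the alternating sum of Gaussian binomial coefficients. -/
lemma alternating_sum_even (s : ℕ) :
    ∑ j ∈ range (2 * s + 1), (-1) ^ j * gaussBinom q (2 * s) j =
      ∏ k ∈ range s, (1 - q ^ (2 * k + 1)) := by
  induction s with
  | zero => simp
  | succ s ih =>
    rw [prod_range_succ, ← ih, mul_comm _ (1 - _)]
    exact alternating_sum_add_two q (2 * s)

lemma eq_of_isPrimitiveRoot {K : Type*} [Field K] {z : K} {s : ℕ}
    (hz : IsPrimitiveRoot z (2 * s + 1)) {j : ℕ} (hj : j ≤ 2 * s) :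
    gaussBinom (z⁻¹ ^ 2) (2 * s) j = (-1) ^ j * z ^ (j * (j + 1)) := by
  have hz0 : z ≠ 0 := hz.ne_zero (by omega)
  have hq : IsPrimitiveRoot (z⁻¹ ^ 2) (2 * s + 1) :=
    hz.inv.pow_of_coprime 2 (by simp)
  induction j with
  | zero => simp
  | succ j ih =>
    have h₁ := one_sub_pow_mul (z⁻¹ ^ 2) (2 * s) j
    rw [hq.pow_eq_one, sub_self, zero_mul] at h₁
    have h₂ := (mul_eq_zero.mp h₁).resolve_left
      (sub_ne_zero.mpr (hq.pow_ne_one_of_pos_of_lt (by omega) (by omega)).symm)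
    rw [succ_succ, ih (by omega)] at h₂
    have h₃ : (z ^ 2) ^ (j + 1) * (z⁻¹ ^ 2) ^ (j + 1) = 1 := by
      rw [← mul_pow, ← mul_pow, mul_inv_cancel₀ hz0, one_pow, one_pow]
    linear_combination (z ^ 2) ^ (j + 1) * h₂ - gaussBinom (z⁻¹ ^ 2) (2 * s) (j + 1) * h₃

end gaussBinom

/-- A product formula for a shifted quadratic Gauss sum. -/
lemma IsPrimitiveRoot.sum_pow_mul_succ {K : Type*} [Field K] {z : K} {s : ℕ}
    (hz : IsPrimitiveRoot z (2 * s + 1)) :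
    ∑ j ∈ range (2 * s + 1), z ^ (j * (j + 1)) =
      ∏ k ∈ range s, (1 - z⁻¹ ^ (2 * (2 * k + 1))) := by
  simp_rw [pow_mul z⁻¹ 2]
  rw [← gaussBinom.alternating_sum_even]
  refine sum_congr rfl fun j hj ↦ ?_
  rw [gaussBinom.eq_of_isPrimitiveRoot hz (by simp at hj; omega), ← mul_assoc, ← mul_pow]
  simp

lemma sum_range_add_of_periodic {M : Type*} [AddCommGroup M] {F : ℕ → M} {n : ℕ}
    (hF : Function.Periodic F n) (a : ℕ) : ∑ x ∈ range n, F (x + a) = ∑ x ∈ range n, F x := by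
  induction a with
  | zero => rfl
  | succ a ih =>
    rw [← ih]
    have h₁ := sum_range_succ (fun x ↦ F (x + a)) n
    have h₂ := sum_range_succ' (fun x ↦ F (x + a)) n
    have h₃ : F (n + a) = F (0 + a) := by rw [add_comm, hF, zero_add]
    rw [h₁, h₃] at h₂
    simpa [add_assoc, add_comm 1] using (add_right_cancel h₂).symm

/-- The quadratic Gauss sum of odd order as a product of sines. -/
lemma sum_exp_sq_eq_prod_sin (s : ℕ) :
    ∑ x ∈ range (2 * s + 1), exp (2 * Real.pi * I / (2 * s + 1 : ℕ)) ^ (x ^ 2) =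
      (2 * I) ^ s * ((∏ k ∈ range s,
        Real.sin (2 * Real.pi * (2 * k + 1) / (2 * s + 1 : ℕ)) : ℝ) : ℂ) := by
  set n := 2 * s + 1 with hn
  set z := exp (2 * Real.pi * I / (n : ℕ)) with hzdef
  have hz : IsPrimitiveRoot z n := isPrimitiveRoot_exp n (by omega)
  have hz0 : z ≠ 0 := hz.ne_zero (by omega)
  have hper : Function.Periodic (fun x : ℕ ↦ z ^ (x ^ 2)) n := fun x ↦ by
    have : (x + n) ^ 2 = x ^ 2 + n * (2 * x + n) := by ring
    simp only [this, pow_add, pow_mul, hz.pow_eq_one, one_pow, mul_one]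
  rw [← sum_range_add_of_periodic hper (s + 1)]
  have hshift (x : ℕ) : z ^ ((x + (s + 1)) ^ 2) = z ^ ((s + 1) ^ 2) * z ^ (x * (x + 1)) := by
    have : (x + (s + 1)) ^ 2 = n * x + ((s + 1) ^ 2 + x * (x + 1)) := by rw [hn]; ring
    rw [this, pow_add, pow_mul, hz.pow_eq_one, one_pow, one_mul, pow_add]
  simp_rw [hshift]
  rw [← mul_sum, hz.sum_pow_mul_succ]
  have hfac (k : ℕ) : 1 - z⁻¹ ^ (2 * (2 * k + 1)) =
      z⁻¹ ^ (2 * k + 1) * (2 * I *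
        ((Real.sin (2 * Real.pi * (2 * k + 1) / n) : ℝ) : ℂ)) := by
    have h₁ : z ^ (2 * k + 1) = exp (2 * Real.pi * (2 * k + 1) / n * I) := by
      rw [hzdef, ← exp_nat_mul]; congr 1; push_cast; ring
    have h₂ : z⁻¹ ^ (2 * k + 1) = exp (-(2 * Real.pi * (2 * k + 1) / n) * I) := by
      rw [inv_pow, h₁, ← exp_neg, neg_mul]
    have h₃ : z⁻¹ ^ (2 * k + 1) * z ^ (2 * k + 1) = 1 := by
      rw [← mul_pow, inv_mul_cancel₀ hz0, one_pow]
    rw [ofReal_sin, sin]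
    push_cast
    rw [← h₁, ← h₂, mul_comm 2, pow_mul]
    linear_combination -h₃ - (z⁻¹ ^ (2 * k + 1) *
      (z⁻¹ ^ (2 * k + 1) - z ^ (2 * k + 1))) * I_sq
  rw [prod_congr rfl fun k _ ↦ hfac k, prod_mul_distrib, prod_mul_distrib, prod_pow_eq_pow_sum,
    prod_const, card_range, ofReal_prod]
  have hodd : ∑ k ∈ range s, (2 * k + 1) = s ^ 2 := by
    clear * -
    induction s with
    | zero => rfl
    | succ s ih => rw [sum_range_succ, ih]; ring
  have hphase : z ^ ((s + 1) ^ 2) * z⁻¹ ^ (s ^ 2) = 1 := by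
    have : (s + 1) ^ 2 = n + s ^ 2 := by rw [hn]; ring
    rw [this, pow_add, hz.pow_eq_one, one_mul, ← mul_pow, mul_inv_cancel₀ hz0, one_pow]
  rw [hodd, ← mul_assoc, hphase, one_mul]

/-- The quadratic Gauss sum of order `4 t + 3` has positive imaginary part. -/
lemma im_sum_exp_sq_pos (t : ℕ) :
    0 < (∑ x ∈ range (4 * t + 3), exp (2 * Real.pi * I / (4 * t + 3 : ℕ)) ^ (x ^ 2)).im := by
  have h := sum_exp_sq_eq_prod_sin (2 * t + 1)
  rw [show 2 * (2 * t + 1) + 1 = 4 * t + 3 by ring] at h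
  rw [h, mul_pow, pow_succ I, pow_mul, I_sq]
  set f : ℕ → ℝ := fun k ↦ Real.sin (2 * Real.pi * (2 * k + 1) / (4 * t + 3 : ℕ)) with hf
  have hn : (0 : ℝ) < (4 * t + 3 : ℕ) := by positivity
  have hpos : ∀ k ∈ range (t + 1), 0 < f k := fun k hk ↦ by
    have hk' : (k : ℝ) ≤ t := by exact_mod_cast Nat.lt_succ_iff.mp (mem_range.mp hk)
    refine Real.sin_pos_of_pos_of_lt_pi (by positivity) ?_
    rw [div_lt_iff₀ hn]
    push_cast
    nlinarith [Real.pi_pos]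
  have hneg : ∀ k ∈ range t, 0 < -f (t + 1 + k) := fun k hk ↦ by
    have hk' : (k : ℝ) + 1 ≤ t := by exact_mod_cast mem_range.mp hk
    rw [hf, ← Real.sin_sub_pi]
    refine Real.sin_pos_of_pos_of_lt_pi ?_ ?_
    · rw [sub_pos, lt_div_iff₀ hn]
      push_cast
      nlinarith [Real.pi_pos, mul_nonneg Real.pi_pos.le (Nat.cast_nonneg (α := ℝ) k)]
    · rw [sub_lt_iff_lt_add, div_lt_iff₀ hn]
      push_cast
      nlinarith [Real.pi_pos]
  have hprod : (-1) ^ t * ∏ k ∈ range (2 * t + 1), f k =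
      (∏ k ∈ range (t + 1), f k) * ∏ k ∈ range t, -f (t + 1 + k) := by
    rw [show 2 * t + 1 = t + 1 + t by ring, prod_range_add, prod_neg, card_range]
    ring
  have : ((2 : ℂ) ^ (2 * t + 1) * ((-1) ^ t * I) * ((∏ k ∈ range (2 * t + 1), f k : ℝ) : ℂ)) =
      ((2 ^ (2 * t + 1) * ((-1) ^ t * ∏ k ∈ range (2 * t + 1), f k) : ℝ) : ℂ) * I := by
    push_cast; ring
  rw [this, mul_I_im, ofReal_re, hprod]
  have := prod_pos hpos
  have := prod_pos hneg
  positivity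

open NumberTheorySymbols

/-- The additive character `k ↦ exp (2 π i k / n)`. -/
noncomputable def expRoot (n k : ℕ) : ℂ := exp (2 * Real.pi * I * k / n)

lemma expRoot_add (n a b : ℕ) : expRoot n (a + b) = expRoot n a * expRoot n b := by
  rw [expRoot, expRoot, expRoot, ← exp_add]; congr 1; push_cast; ring

lemma expRoot_mul_cancel {a : ℕ} (ha : a ≠ 0) (b x : ℕ) :
    expRoot (a * b) (a * x) = expRoot b x := by
  have : (a : ℂ) ≠ 0 := by exact_mod_cast ha
  rw [expRoot, expRoot, Nat.cast_mul, Nat.cast_mul, mul_left_comm, mul_div_mul_left _ _ this]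

lemma expRoot_eq_stdAddChar (n : ℕ) [NeZero n] (k : ℕ) :
    expRoot n k = ZMod.stdAddChar (k : ZMod n) := by
  have := ZMod.stdAddChar_coe (N := n) k
  rw [Int.cast_natCast] at this
  rw [this, expRoot, Int.cast_natCast]

lemma expRoot_congr {n : ℕ} [NeZero n] {a b : ℕ} (h : a ≡ b [MOD n]) :
    expRoot n a = expRoot n b := by
  rw [expRoot_eq_stdAddChar, expRoot_eq_stdAddChar, (ZMod.natCast_eq_natCast_iff a b n).mpr h]

lemma jacobiSym_natCast_congr {n a b : ℕ} (h : a ≡ b [MOD n]) : J(a | n) = J(b | n) :=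
  jacobiSym.mod_left' (by exact_mod_cast h)

/-- The Gauss sum of the Jacobi symbol modulo `n`. -/
noncomputable def jacobiGaussSum (n k : ℕ) : ℂ :=
  ∑ x ∈ range n, (J(x | n) : ℂ) * expRoot n (k * x)

/-- The quadratic Gauss sum modulo `n`. -/
noncomputable def quadGaussSum (n k : ℕ) : ℂ :=
  ∑ x ∈ range n, expRoot n (k * x ^ 2)

lemma sum_range_mul_of_coprime {M : Type*} [AddCommMonoid M] {a b : ℕ} (ha : a ≠ 0) (hb : b ≠ 0)
    (hab : a.Coprime b) {F : ℕ → M} (hF : ∀ x y, x ≡ y [MOD a * b] → F x = F y) :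
    ∑ x ∈ range (a * b), F x = ∑ i ∈ range a, ∑ j ∈ range b, F (b * i + a * j) := by
  rw [← sum_product']
  symm
  have hmaps : ∀ x ∈ range a ×ˢ range b, (b * x.1 + a * x.2) % (a * b) ∈ range (a * b) :=
    fun x _ ↦ mem_range.mpr (Nat.mod_lt _ (by positivity))
  have hinj : Set.InjOn (fun x : ℕ × ℕ ↦ (b * x.1 + a * x.2) % (a * b))
      (range a ×ˢ range b : Finset (ℕ × ℕ)) := by
    rintro ⟨i, j⟩ hx ⟨i', j'⟩ hy h
    simp only [coe_product, coe_range, Set.mem_prod, Set.mem_Iio] at hx hy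
    change b * i + a * j ≡ b * i' + a * j' [MOD a * b] at h
    have h₁ : b * i ≡ b * i' [MOD a] := by
      have := h.of_mul_right b
      simpa [Nat.ModEq, Nat.add_mod] using this
    have h₂ : a * j ≡ a * j' [MOD b] := by
      have := h.of_mul_left a
      simpa [Nat.ModEq, Nat.add_mod] using this
    rw [Prod.mk.injEq]
    exact ⟨(h₁.cancel_left_of_coprime hab).eq_of_lt_of_lt hx.1 hy.1,
      (h₂.cancel_left_of_coprime hab.symm).eq_of_lt_of_lt hx.2 hy.2⟩
  refine sum_nbij _ hmaps hinj ?_ fun x _ ↦ hF _ _ (Nat.mod_modEq _ _).symm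
  exact surjOn_of_injOn_of_card_le _ hmaps hinj (by simp)

lemma jacobiGaussSum_mul {a b : ℕ} (ha : a ≠ 0) (hb : b ≠ 0) (hab : a.Coprime b) (k : ℕ) :
    jacobiGaussSum (a * b) k =
      J(b | a) * J(a | b) * jacobiGaussSum a k * jacobiGaussSum b k := by
  have : NeZero (a * b) := ⟨mul_ne_zero ha hb⟩
  rw [jacobiGaussSum, sum_range_mul_of_coprime ha hb hab, mul_assoc, jacobiGaussSum,
    jacobiGaussSum, sum_mul_sum, mul_sum]
  · refine sum_congr rfl fun i _ ↦ ?_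
    rw [mul_sum]
    refine sum_congr rfl fun j _ ↦ ?_
    have h₁ : J((b * i + a * j : ℕ) | a) = J(b | a) * J(i | a) := by
      rw [← jacobiSym.mul_left, ← Nat.cast_mul]
      exact jacobiSym_natCast_congr (by simp [Nat.ModEq])
    have h₂ : J((b * i + a * j : ℕ) | b) = J(a | b) * J(j | b) := by
      rw [← jacobiSym.mul_left, ← Nat.cast_mul]
      exact jacobiSym_natCast_congr (by simp [Nat.ModEq])
    have h₃ : k * (b * i + a * j) = b * (k * i) + a * (k * j) := by ring
    rw [jacobiSym.mul_right' _ ha hb, h₁, h₂, h₃, expRoot_add, expRoot_mul_cancel ha, mul_comm a b,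
      expRoot_mul_cancel hb]
    push_cast
    ring
  · intro x y h
    rw [jacobiSym_natCast_congr h, expRoot_congr (h.mul_left k)]

lemma quadGaussSum_mul {a b : ℕ} (ha : a ≠ 0) (hb : b ≠ 0) (hab : a.Coprime b) (k : ℕ) :
    quadGaussSum (a * b) k = quadGaussSum a (k * b) * quadGaussSum b (k * a) := by
  have : NeZero (a * b) := ⟨mul_ne_zero ha hb⟩
  rw [quadGaussSum, sum_range_mul_of_coprime ha hb hab, quadGaussSum, quadGaussSum, sum_mul_sum]
  · refine sum_congr rfl fun i _ ↦ sum_congr rfl fun j _ ↦ ?_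
    have h : k * (b * i + a * j) ^ 2 ≡ b * (k * b * i ^ 2) + a * (k * a * j ^ 2) [MOD a * b] := by
      have : k * (b * i + a * j) ^ 2 =
          b * (k * b * i ^ 2) + a * (k * a * j ^ 2) + a * b * (2 * k * i * j) := by ring
      rw [this]
      simp [Nat.ModEq]
    rw [expRoot_congr h, expRoot_add, expRoot_mul_cancel ha, mul_comm a b, expRoot_mul_cancel hb]
  · exact fun x y h ↦ expRoot_congr ((h.pow 2).mul_left k)

lemma sum_range_natCast_zmod {M : Type*} [AddCommMonoid M] (n : ℕ) [NeZero n] (f : ZMod n → M) :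
    ∑ x ∈ range n, f x = ∑ x : ZMod n, f x :=
  sum_bij' (fun x _ ↦ (x : ZMod n)) (fun x _ ↦ x.val) (fun _ _ ↦ mem_univ _)
    (fun x _ ↦ mem_range.mpr x.val_lt)
    (fun _ hx ↦ ZMod.val_cast_of_lt (mem_range.mp hx)) (fun x _ ↦ ZMod.natCast_zmod_val x)
    (fun _ _ ↦ rfl)

section Prime

variable {p : ℕ} [Fact p.Prime]

lemma jacobiSym_eq_quadraticChar (a : ℕ) : J(a | p) = quadraticChar (ZMod p) a := by
  rw [← jacobiSym.legendreSym.to_jacobiSym, legendreSym, Int.cast_natCast]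

/-- The quadratic character modulo a prime with complex values. -/
noncomputable abbrev complexQuadraticChar (p : ℕ) [Fact p.Prime] : MulChar (ZMod p) ℂ :=
  (quadraticChar (ZMod p)).ringHomComp (Int.castRingHom ℂ)

lemma complexQuadraticChar_ne_one (hp : p ≠ 2) : complexQuadraticChar p ≠ 1 := by
  rw [complexQuadraticChar, MulChar.ringHomComp_ne_one_iff Int.cast_injective]
  exact quadraticChar_ne_one (by rwa [ZMod.ringChar_zmod_n])

lemma jacobiGaussSum_prime (k : ℕ) :
    jacobiGaussSum p k =
      gaussSum (complexQuadraticChar p) (AddChar.mulShift ZMod.stdAddChar (k : ZMod p)) := by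
  rw [gaussSum, ← sum_range_natCast_zmod, jacobiGaussSum]
  refine sum_congr rfl fun x _ ↦ ?_
  rw [jacobiSym_eq_quadraticChar, expRoot_eq_stdAddChar, AddChar.mulShift_apply, Nat.cast_mul]
  rfl

lemma jacobiGaussSum_prime_one :
    jacobiGaussSum p 1 = gaussSum (complexQuadraticChar p) ZMod.stdAddChar := by
  rw [jacobiGaussSum_prime, Nat.cast_one, AddChar.mulShift_one]

lemma jacobiGaussSum_prime_eq_mul (hp : p ≠ 2) (k : ℕ) :
    jacobiGaussSum p k = J(k | p) * jacobiGaussSum p 1 := by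
  rw [jacobiGaussSum_prime_one, jacobiGaussSum_prime, jacobiSym_eq_quadraticChar]
  by_cases hk : (k : ZMod p) = 0
  · rw [hk, AddChar.mulShift_zero, gaussSum_one_right (complexQuadraticChar_ne_one hp)]
    simp
  · have h := gaussSum_mulShift (complexQuadraticChar p) ZMod.stdAddChar (Units.mk0 _ hk)
    have hsq : ((quadraticChar (ZMod p) k : ℤ) : ℂ) ^ 2 = 1 := by
      exact_mod_cast quadraticChar_sq_one hk
    have hχ : complexQuadraticChar p (k : ZMod p) = (quadraticChar (ZMod p) k : ℤ) := rfl
    rw [Units.val_mk0, hχ] at h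
    rw [← h, ← mul_assoc, ← sq, hsq, one_mul]

lemma jacobiGaussSum_prime_sq (hp : p ≠ 2) :
    jacobiGaussSum p 1 ^ 2 = J(-1 | p) * p := by
  have hquad : (complexQuadraticChar p).IsQuadratic := (quadraticChar_isQuadratic _).comp _
  rw [jacobiGaussSum_prime_one, gaussSum_sq (χ := complexQuadraticChar p)
    (complexQuadraticChar_ne_one hp) hquad (ZMod.isPrimitive_stdAddChar p), ZMod.card, ← jacobiSym.legendreSym.to_jacobiSym, legendreSym]
  simp

lemma quadGaussSum_prime (hp : p ≠ 2) {k : ℕ} (hk : k.Coprime p) :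
    quadGaussSum p k = jacobiGaussSum p k := by
  have hk0 : (k : ZMod p) ≠ 0 := by
    rw [Ne, ZMod.natCast_eq_zero_iff]
    exact fun h ↦ (Fact.out : p.Prime).one_lt.ne' (Nat.eq_one_of_dvd_coprimes hk h dvd_rfl)
  have h₁ : quadGaussSum p k = ∑ x : ZMod p, ZMod.stdAddChar ((k : ZMod p) * x ^ 2) := by
    rw [← sum_range_natCast_zmod, quadGaussSum]
    exact sum_congr rfl fun x _ ↦ by rw [expRoot_eq_stdAddChar]; push_cast; rfl
  have h₂ : ∑ y : ZMod p, (ZMod.stdAddChar (y * (k : ZMod p)) : ℂ) = 0 := by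
    rw [AddChar.sum_mulShift _ (ZMod.isPrimitive_stdAddChar p), if_neg hk0]; simp
  rw [h₁, jacobiGaussSum_prime, gaussSum, ← sum_fiberwise univ (fun x : ZMod p ↦ x ^ 2),
    ← add_zero (∑ a, _ * _), ← h₂, ← sum_add_distrib]
  refine sum_congr rfl fun y _ ↦ ?_
  have hcard := quadraticChar_card_sqrts (F := ZMod p) (by rwa [ZMod.ringChar_zmod_n]) y
  have hset : ({x : ZMod p | x ^ 2 = y} : Set (ZMod p)).toFinset =
      univ.filter fun x ↦ x ^ 2 = y := by ext; simp
  rw [hset] at hcard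
  have hcard' : (#(univ.filter fun x : ZMod p ↦ x ^ 2 = y) : ℂ) =
      (quadraticChar (ZMod p) y : ℤ) + 1 := by exact_mod_cast hcard
  rw [sum_congr rfl fun x hx ↦ by rw [(mem_filter.mp hx).2], sum_const, nsmul_eq_mul, hcard',
    AddChar.mulShift_apply, add_mul, one_mul, mul_comm y]
  rfl

end Prime

/-- Separability, comparison with the quadratic Gauss sum, and the square of the Gauss sum of the
Jacobi symbol. -/
lemma jacobiGaussSum_of_squarefree (n : ℕ) (hn : Odd n) (hsf : Squarefree n) :
    (∀ k, jacobiGaussSum n k = J(k | n) * jacobiGaussSum n 1) ∧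
      (∀ k, k.Coprime n → quadGaussSum n k = jacobiGaussSum n k) ∧
      jacobiGaussSum n 1 ^ 2 = J(-1 | n) * n := by
  induction n using induction_on_primes with
  | zero => simp at hn
  | one => simp [jacobiGaussSum, quadGaussSum, expRoot]
  | prime_mul p m hp ih =>
    have : Fact p.Prime := ⟨hp⟩
    obtain ⟨hop, hom⟩ := Nat.odd_mul.mp hn
    obtain ⟨hpm, -, hm⟩ := Nat.squarefree_mul_iff.mp hsf
    obtain ⟨ih₁, ih₂, ih₃⟩ := ih hom hm
    have hp2 : p ≠ 2 := by rintro rfl; exact absurd hop (by decide)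
    have hm0 : m ≠ 0 := hm.ne_zero
    have hmul := jacobiGaussSum_mul hp.ne_zero hm0 hpm
    have hprime := jacobiGaussSum_prime_eq_mul (p := p) hp2
    refine ⟨fun k ↦ ?_, fun k hk ↦ ?_, ?_⟩
    · rw [hmul, hmul, ih₁ k, hprime k, jacobiSym.mul_right' _ hp.ne_zero hm0]
      push_cast
      ring
    · obtain ⟨hkp, hkm⟩ := Nat.coprime_mul_iff_right.mp hk
      rw [hmul, quadGaussSum_mul hp.ne_zero hm0 hpm,
        quadGaussSum_prime hp2 (hkp.mul_left hpm.symm), ih₂ _ (hkm.mul_left hpm), ih₁ k, hprime k,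
        ih₁ (k * p), hprime (k * m), Nat.cast_mul, Nat.cast_mul, jacobiSym.mul_left,
        jacobiSym.mul_left]
      push_cast
      ring
    · have h₁ : (J(m | p) : ℂ) ^ 2 = 1 := by
        exact_mod_cast jacobiSym.sq_one (by simpa using hpm.symm)
      have h₂ : (J(p | m) : ℂ) ^ 2 = 1 := by
        exact_mod_cast jacobiSym.sq_one (by simpa using hpm)
      rw [hmul, mul_pow, mul_pow, mul_pow, h₁, h₂, ih₃, jacobiGaussSum_prime_sq hp2,
        jacobiSym.mul_right' _ hp.ne_zero hm0]
      push_cast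
      ring

lemma jacobiGaussSum_one_eq {n : ℕ} (hsf : Squarefree n) (hmod : n % 4 = 3) :
    jacobiGaussSum n 1 = (Real.sqrt n : ℝ) * I := by
  have hodd : Odd n := Nat.odd_iff.mpr (by omega)
  obtain ⟨-, h₂, h₃⟩ := jacobiGaussSum_of_squarefree n hodd hsf
  have him : 0 < (jacobiGaussSum n 1).im := by
    rw [← h₂ 1 (Nat.coprime_one_left n)]
    have h := im_sum_exp_sq_pos (n / 4)
    rw [show 4 * (n / 4) + 3 = n by omega] at h
    convert h using 2
    refine sum_congr rfl fun x _ ↦ ?_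
    rw [expRoot, ← exp_nat_mul]
    congr 1
    push_cast
    ring
  rw [jacobiSym.at_neg_one hodd, ZMod.χ₄_nat_three_mod_four hmod] at h₃
  have hsqrt : ((Real.sqrt n : ℝ) : ℂ) ^ 2 = n := by
    rw [← ofReal_pow, Real.sq_sqrt n.cast_nonneg, ofReal_natCast]
  have hsq : jacobiGaussSum n 1 ^ 2 = ((Real.sqrt n : ℝ) * I) ^ 2 := by
    rw [h₃, mul_pow, hsqrt, I_sq]; push_cast; ring
  rcases sq_eq_sq_iff_eq_or_eq_neg.mp hsq with h | h
  · exact h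
  · rw [h, neg_im, mul_I_im, ofReal_re] at him
    linarith [Real.sqrt_nonneg n]

lemma sum_jacobiSym_mul_sin {n : ℕ} (hsf : Squarefree n) (hmod : n % 4 = 3) (k : ℕ) :
    ∑ x ∈ range n, (J(x | n) : ℝ) * Real.sin (2 * Real.pi * k * x / n) =
      J(k | n) * Real.sqrt n := by
  have h := (jacobiGaussSum_of_squarefree n (Nat.odd_iff.mpr (by omega)) hsf).1 k
  rw [jacobiGaussSum_one_eq hsf hmod, jacobiGaussSum] at h
  have h' := congrArg im h
  rw [im_sum, ← ofReal_intCast, im_ofReal_mul, mul_I_im, ofReal_re] at h'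
  rw [← h']
  refine sum_congr rfl fun x _ ↦ ?_
  rw [← ofReal_intCast, im_ofReal_mul, expRoot, ← exp_ofReal_mul_I_im]
  congr 3
  push_cast
  ring

lemma sum_range_eq_two_mul_of_symm {N : ℕ} {F : ℕ → ℝ} (h0 : F 0 = 0)
    (hF : ∀ x < N, F (N + 1 + x) = F (N - x)) :
    ∑ x ∈ range (2 * N + 1), F x = 2 * ∑ x ∈ range N, F (x + 1) := by
  rw [sum_range_succ', h0, add_zero, two_mul, sum_range_add, two_mul]
  congr 1
  rw [← sum_range_reflect (fun x ↦ F (x + 1))]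
  refine sum_congr rfl fun x hx ↦ ?_
  have hx := mem_range.mp hx
  rw [add_right_comm, hF x hx]
  congr 1
  omega

theorem stmt_3 (N : ℕ) (hN : 1 ≤ N) (p : ℕ) (hp : p = 2 * N + 1)
    (hsf : Squarefree p) (hmod : p % 4 = 3)
    (J : Matrix (Fin N) (Fin N) ℝ)
    (hJ : ∀ k x : Fin N, J k x =
      (2 / Real.sqrt p) * Real.sin (2 * Real.pi * ((k : ℕ) + 1) * ((x : ℕ) + 1) / p))
    (ψ : Fin N → ℝ)
    (hψ : ∀ x : Fin N, ψ x = ((jacobiSym ((x : ℕ) + 1 : ℤ) p : ℤ) : ℝ)) :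
    J.mulVec ψ = ψ := by
  have hp0 : (0 : ℝ) < p := by exact_mod_cast (by omega : 0 < p)
  have hodd : Odd p := ⟨N, hp⟩
  ext k
  have h := sum_jacobiSym_mul_sin hsf hmod (k + 1)
  set F : ℕ → ℝ := fun x ↦
    (jacobiSym x p : ℝ) * Real.sin (2 * Real.pi * (k + 1 : ℕ) * x / p) with hFdef
  have hrefl : ∀ x < N, F (N + 1 + x) = F (N - x) := fun x hx ↦ by
    obtain ⟨y, rfl⟩ := Nat.exists_eq_add_of_le hx.le
    have hy : x + y - x = y := by omega
    have hxy : ((x + y + 1 + x : ℕ) : ℤ) = p - y := by rw [hp]; push_cast; ring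
    have hxy' : ((x + y + 1 + x : ℕ) : ℝ) = p - y := by rw [hp]; push_cast; ring
    have hchar : jacobiSym ((x + y + 1 + x : ℕ) : ℤ) p = -jacobiSym y p := by
      rw [hxy, jacobiSym.mod_left' (show ((p : ℤ) - y) % p = (-y) % p by simp),
        jacobiSym.neg _ hodd, ZMod.χ₄_nat_three_mod_four hmod, neg_one_mul]
    have hsin : Real.sin (2 * Real.pi * (k + 1 : ℕ) * (x + y + 1 + x : ℕ) / p) =
        -Real.sin (2 * Real.pi * (k + 1 : ℕ) * y / p) := by
      rw [hxy', ← Real.sin_nat_mul_two_pi_sub]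
      congr 1
      field_simp
    simp only [hFdef, hy, hchar, hsin]
    push_cast
    ring
  have hsum : ∑ x ∈ range (2 * N + 1), F x = 2 * ∑ x ∈ range N, F (x + 1) :=
    sum_range_eq_two_mul_of_symm (by simp [hFdef]) hrefl
  rw [← hp, h] at hsum
  have hsqrt : Real.sqrt p ≠ 0 := (Real.sqrt_pos.mpr hp0).ne'
  have hentry : J.mulVec ψ k = 2 / Real.sqrt p * ∑ x ∈ range N, F (x + 1) := by
    rw [← Fin.sum_univ_eq_sum_range (fun x ↦ F (x + 1)), mul_sum, Matrix.mulVec, dotProduct]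
    refine sum_congr rfl fun x _ ↦ ?_
    rw [hJ, hψ]
    simp only [hFdef]
    push_cast
    ring
  rw [hentry, div_mul_eq_mul_div, ← hsum, mul_div_cancel_right₀ _ hsqrt, hψ]
  push_cast
  rfl
end

section
/- Let p = 2N+1 be a prime with p ≡ 1 (mod 4) and λ² ≡ -1 (mod p). Define Φ_h⁻(x) = Φ_k⁺(λx mod p) whenever h ≡ λk (mod p), where Φ_k⁺(x) = (1/√p)[cos(2πλ2⁻¹x²/p)sin(2πkx/p) + sin(2πλ2⁻¹(k²+x²)/p)sin(2πλkx/p)]. Then S Φ_k⁺ = Φ_k⁺ and S Φ_h⁻ = -Φ_h⁻, where S is the (p-1)×(p-1) matrix S_{x,y} = (1/√p)sin(2πxy/p), x,y = 1,…,p-1. -/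
open Finset Matrix

/-- `cos (2πz/p)` for a residue class `z` modulo `p`. -/
noncomputable def zmodCos {p : ℕ} [NeZero p] (z : ZMod p) : ℝ := (ZMod.stdAddChar z).re

/-- `sin (2πz/p)` for a residue class `z` modulo `p`. -/
noncomputable def zmodSin {p : ℕ} [NeZero p] (z : ZMod p) : ℝ := (ZMod.stdAddChar z).im

section Trig

variable {p : ℕ} [NeZero p]

lemma stdAddChar_intCast_eq (j : ℤ) :
    ZMod.stdAddChar (j : ZMod p) = Complex.exp ((2 * Real.pi * j / p : ℝ) * Complex.I) := by
  rw [ZMod.stdAddChar_coe]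
  congr 1
  push_cast
  ring

lemma zmodCos_intCast (j : ℤ) : zmodCos (j : ZMod p) = Real.cos (2 * Real.pi * j / p) := by
  rw [zmodCos, stdAddChar_intCast_eq, Complex.exp_ofReal_mul_I_re]

lemma zmodSin_intCast (j : ℤ) : zmodSin (j : ZMod p) = Real.sin (2 * Real.pi * j / p) := by
  rw [zmodSin, stdAddChar_intCast_eq, Complex.exp_ofReal_mul_I_im]

lemma zmodCos_add (x y : ZMod p) :
    zmodCos (x + y) = zmodCos x * zmodCos y - zmodSin x * zmodSin y := by
  simp [zmodCos, zmodSin, AddChar.map_add_eq_mul]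

lemma zmodSin_add (x y : ZMod p) :
    zmodSin (x + y) = zmodSin x * zmodCos y + zmodCos x * zmodSin y := by
  simp [zmodCos, zmodSin, AddChar.map_add_eq_mul, add_comm]

@[simp] lemma zmodCos_zero : zmodCos (0 : ZMod p) = 1 := by simp [zmodCos]

@[simp] lemma zmodSin_zero : zmodSin (0 : ZMod p) = 0 := by simp [zmodSin]

@[simp] lemma zmodCos_neg (x : ZMod p) : zmodCos (-x) = zmodCos x := by
  obtain ⟨j, rfl⟩ := ZMod.intCast_surjective x
  rw [← Int.cast_neg, zmodCos_intCast, zmodCos_intCast, ← Real.cos_neg]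
  congr 1
  push_cast
  ring

@[simp] lemma zmodSin_neg (x : ZMod p) : zmodSin (-x) = -zmodSin x := by
  obtain ⟨j, rfl⟩ := ZMod.intCast_surjective x
  rw [← Int.cast_neg, zmodSin_intCast, zmodSin_intCast, ← Real.sin_neg]
  congr 1
  push_cast
  ring

lemma zmodCos_sub (x y : ZMod p) :
    zmodCos (x - y) = zmodCos x * zmodCos y + zmodSin x * zmodSin y := by
  rw [sub_eq_add_neg, zmodCos_add]
  simp

lemma zmodSin_sub (x y : ZMod p) :
    zmodSin (x - y) = zmodSin x * zmodCos y - zmodCos x * zmodSin y := by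
  rw [sub_eq_add_neg, zmodSin_add]
  simp [sub_eq_add_neg]

/-- Orthogonality relation for the cosine. -/
lemma sum_zmodCos_mul (b : ZMod p) :
    ∑ x : ZMod p, zmodCos (x * b) = if b = 0 then (p : ℝ) else 0 := by
  have h := congrArg Complex.re (AddChar.sum_mulShift b (ZMod.isPrimitive_stdAddChar p))
  rw [Complex.re_sum] at h
  simp only [zmodCos, h, ZMod.card]
  split_ifs <;> simp

/-- The sum of an odd function on `ZMod p` vanishes. -/
lemma sum_zmod_eq_zero_of_odd (f : ZMod p → ℝ) (hf : ∀ x, f (-x) = -f x) :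
    ∑ x, f x = 0 := by
  have h : ∑ x, f (-x) = ∑ x, f x := Equiv.sum_comp (Equiv.neg (ZMod p)) f
  simp only [hf, sum_neg_distrib] at h
  linarith

end Trig

lemma sum_zmod_eq_sum_range {p : ℕ} [NeZero p] (f : ZMod p → ℝ) :
    ∑ x, f x = ∑ i ∈ range p, f (i : ZMod p) := by
  symm
  refine sum_bij (fun i _ => (i : ZMod p)) (by simp) ?_ ?_ (by simp)
  · intro i hi j hj h
    rw [ZMod.natCast_eq_natCast_iff'] at h
    rwa [Nat.mod_eq_of_lt (mem_range.1 hi), Nat.mod_eq_of_lt (mem_range.1 hj)] at h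
  · intro x _
    exact ⟨x.val, mem_range.2 x.val_lt, by simp⟩

/-- The sum of an even function on `ZMod (2N+1)`, in terms of the representatives `0, …, N`. -/
lemma sum_zmod_of_even {N : ℕ} (f : ZMod (2 * N + 1) → ℝ) (hf : ∀ x, f (-x) = f x) :
    ∑ x, f x = ∑ i : Fin (N + 1), (if i = 0 then 1 else 2) * f ((i : ℕ) : ZMod (2 * N + 1)) := by
  rw [sum_zmod_eq_sum_range, Fin.sum_univ_succ]
  simp only [Fin.succ_ne_zero, if_true, if_false, ← mul_sum, Fin.val_succ, Fin.val_zero, one_mul]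
  have split (g : ℕ → ℝ) :
      ∑ k ∈ range (2 * N), g k = ∑ k ∈ range N, g k + ∑ k ∈ range N, g (N + k) := by
    rw [two_mul, sum_range_add]
  rw [Fin.sum_univ_eq_sum_range (fun i => f ((i + 1 : ℕ) : ZMod (2 * N + 1))), sum_range_succ',
    split, add_comm, two_mul (∑ i ∈ range N, _)]
  congr 2
  rw [← sum_range_reflect]
  refine sum_congr rfl fun i hi => ?_
  rw [← hf]
  congr 1
  have hi := mem_range.1 hi
  rw [neg_eq_iff_add_eq_zero, ← Nat.cast_add]
  have : N + (N - 1 - i) + 1 + (i + 1) = 2 * N + 1 := by omega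
  rw [this, ZMod.natCast_self]

/-- A matrix squaring to `r² • 1` has only the eigenvalues `±r`. -/
lemma trace_det_of_mul_self_eq {n : ℕ} (M : Matrix (Fin n) (Fin n) ℝ) (r : ℝ)
    (hM : M * M = (r ^ 2) • (1 : Matrix (Fin n) (Fin n) ℝ)) :
    ∃ b : ℕ, M.trace = r * (n - 2 * b) ∧ M.det = r ^ n * (-1) ^ b := by
  have key : ∀ s : Multiset ℂ, (∀ x ∈ s, x = r ∨ x = -r) →
      ∃ b : ℕ, s.sum = r * (s.card - 2 * b) ∧ s.prod = (r : ℂ) ^ s.card * (-1) ^ b := by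
    intro s
    induction s using Multiset.induction with
    | empty => exact fun _ => ⟨0, by simp⟩
    | cons a s ih =>
      intro h
      obtain ⟨b, h1, h2⟩ := ih fun x hx => h x (Multiset.mem_cons_of_mem hx)
      rcases h a (Multiset.mem_cons_self a s) with rfl | rfl
      · refine ⟨b, ?_, ?_⟩
        · simp [h1]; ring
        · simp [h2]; ring
      · refine ⟨b + 1, ?_, ?_⟩
        · simp [h1]; ring
        · simp [h2]; ring
  set A : Matrix (Fin n) (Fin n) ℂ := M.map Complex.ofRealHom with hA
  have hAA : A * A = ((r : ℂ) ^ 2) • (1 : Matrix (Fin n) (Fin n) ℂ) := by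
    rw [hA, ← Matrix.map_mul, hM]
    ext i j
    by_cases h : i = j <;> simp [h]
  have hcard : A.charpoly.roots.card = n := by
    rw [← (IsAlgClosed.splits A.charpoly).natDegree_eq_card_roots, A.charpoly_natDegree_eq_dim,
      Fintype.card_fin]
  have hroots : ∀ x ∈ A.charpoly.roots, x = r ∨ x = -r := by
    intro x hx
    have hx := Polynomial.isRoot_of_mem_roots hx
    rw [← Matrix.mem_spectrum_iff_isRoot_charpoly, ← Matrix.spectrum_toLin',
      ← Module.End.hasEigenvalue_iff_mem_spectrum] at hx
    obtain ⟨v, hv⟩ := hx.exists_hasEigenvector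
    have hv1 : A *ᵥ v = x • v := hv.apply_eq_smul
    have hv2 : A *ᵥ (A *ᵥ v) = (r : ℂ) ^ 2 • v := by
      rw [mulVec_mulVec, hAA, smul_mulVec, one_mulVec]
    rw [hv1, mulVec_smul, hv1, smul_smul] at hv2
    have := smul_left_injective ℂ hv.2 hv2
    exact sq_eq_sq_iff_eq_or_eq_neg.1 (by rw [← this, sq])
  obtain ⟨b, h1, h2⟩ := key _ hroots
  rw [← Matrix.trace_eq_sum_roots_charpoly, hcard] at h1
  rw [← Matrix.det_eq_prod_roots_charpoly, hcard] at h2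
  refine ⟨b, ?_, ?_⟩
  · have : ((M.trace : ℝ) : ℂ) = A.trace := by
      simp [hA, Matrix.trace]
    rw [← this] at h1
    exact_mod_cast h1
  · have : ((M.det : ℝ) : ℂ) = A.det := by
      rw [hA]; exact Complex.ofRealHom.map_det M
    rw [← this] at h2
    exact_mod_cast h2

lemma natDegree_and_monic_chebyshev_C (n : ℕ) :
    (Polynomial.Chebyshev.C ℝ (n + 1 : ℕ)).natDegree = n + 1 ∧
      (Polynomial.Chebyshev.C ℝ (n + 1 : ℕ)).Monic := by
  induction n using Nat.twoStepInduction with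
  | zero => simp
  | one =>
    have : (Polynomial.Chebyshev.C ℝ ((1 + 1 : ℕ) : ℤ)) =
        Polynomial.X ^ 2 - Polynomial.C 2 := by
      exact Polynomial.Chebyshev.C_two ℝ
    rw [this]
    exact ⟨Polynomial.natDegree_X_pow_sub_C, Polynomial.monic_X_pow_sub_C _ (by norm_num)⟩
  | more n ih1 ih2 =>
    have : (Polynomial.Chebyshev.C ℝ ((n + 2 + 1 : ℕ) : ℤ)) =
        Polynomial.X * Polynomial.Chebyshev.C ℝ ((n + 1 + 1 : ℕ) : ℤ) -
          Polynomial.Chebyshev.C ℝ ((n + 1 : ℕ) : ℤ) := by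
      have h := Polynomial.Chebyshev.C_add_two ℝ ((n + 1 : ℕ) : ℤ)
      push_cast at h ⊢
      convert h using 2; ring
    have hm := Polynomial.monic_X.mul ih2.2
    have hd : (Polynomial.X * Polynomial.Chebyshev.C ℝ ((n + 1 + 1 : ℕ) : ℤ)).natDegree
        = n + 3 := by
      rw [Polynomial.monic_X.natDegree_mul ih2.2, ih2.1, Polynomial.natDegree_X]; ring
    have hlt : (Polynomial.Chebyshev.C ℝ ((n + 1 : ℕ) : ℤ)).degree <
        (Polynomial.X * Polynomial.Chebyshev.C ℝ ((n + 1 + 1 : ℕ) : ℤ)).degree :=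
      Polynomial.degree_lt_degree (by rw [hd, ih1.1]; omega)
    rw [this]
    refine ⟨?_, hm.sub_of_left hlt⟩
    rw [Polynomial.natDegree_eq_of_degree_eq (Polynomial.degree_sub_eq_left_of_degree_lt hlt), hd]

/-- The matrix of `√p` times the discrete Fourier transform on even functions on `ZMod (2N+1)`. -/
noncomputable def evenFourierMatrix (N : ℕ) : Matrix (Fin (N + 1)) (Fin (N + 1)) ℝ :=
  Matrix.of fun i j => (if j = 0 then 1 else 2) *
    zmodCos (((i : ℕ) : ZMod (2 * N + 1)) * ((j : ℕ) : ZMod (2 * N + 1)))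

lemma trace_evenFourierMatrix (N : ℕ) :
    (evenFourierMatrix N).trace = ∑ x : ZMod (2 * N + 1), zmodCos (x ^ 2) := by
  rw [sum_zmod_of_even _ (by simp)]
  simp [evenFourierMatrix, Matrix.trace, sq]

lemma evenFourierMatrix_mul_self (N : ℕ) :
    evenFourierMatrix N * evenFourierMatrix N =
      ((2 * N + 1 : ℕ) : ℝ) • (1 : Matrix (Fin (N + 1)) (Fin (N + 1)) ℝ) := by
  ext y z
  set Y : ZMod (2 * N + 1) := ((y : ℕ) : ZMod (2 * N + 1)) with hY
  set Z : ZMod (2 * N + 1) := ((z : ℕ) : ZMod (2 * N + 1)) with hZ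
  have hsum : ∑ x : ZMod (2 * N + 1), zmodCos (Y * x) * zmodCos (x * Z) =
      ((if Y + Z = 0 then ((2 * N + 1 : ℕ) : ℝ) else 0) +
        (if Y - Z = 0 then ((2 * N + 1 : ℕ) : ℝ) else 0)) / 2 := by
    rw [← sum_zmodCos_mul, ← sum_zmodCos_mul, ← sum_add_distrib, sum_div]
    refine sum_congr rfl fun x _ => ?_
    rw [mul_add, mul_sub, zmodCos_add, zmodCos_sub, mul_comm Y x]
    ring
  have hadd : Y + Z = 0 ↔ y = 0 ∧ z = 0 := by
    rw [hY, hZ, ← Nat.cast_add, ZMod.natCast_eq_zero_iff]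
    constructor
    · intro h
      have := Nat.eq_zero_of_dvd_of_lt h (by omega)
      exact ⟨Fin.ext (by rw [Fin.val_zero]; omega), Fin.ext (by rw [Fin.val_zero]; omega)⟩
    · rintro ⟨rfl, rfl⟩; simp
  have hsub : Y - Z = 0 ↔ y = z := by
    rw [sub_eq_zero, hY, hZ, ZMod.natCast_eq_natCast_iff', Nat.mod_eq_of_lt (by omega),
      Nat.mod_eq_of_lt (by omega), Fin.ext_iff]
  have hentry : (evenFourierMatrix N * evenFourierMatrix N) y z =
      (if z = 0 then 1 else 2) * ∑ x : ZMod (2 * N + 1), zmodCos (Y * x) * zmodCos (x * Z) := by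
    rw [sum_zmod_of_even _ (by simp), Matrix.mul_apply, mul_sum]
    refine sum_congr rfl fun i _ => ?_
    simp only [evenFourierMatrix, Matrix.of_apply]
    ring
  rw [hentry, hsum, Matrix.smul_apply, Matrix.one_apply]
  simp only [hadd, hsub, smul_eq_mul]
  by_cases h1 : y = z
  · subst h1
    by_cases h2 : y = 0 <;> simp [h2, mul_div_cancel₀]
  · have : ¬ (y = 0 ∧ z = 0) := fun h => h1 (h.1.trans h.2.symm)
    simp [h1, this]

lemma zmodCos_natCast_strictAnti {N i j : ℕ} (hij : i < j) (hj : j ≤ N) :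
    zmodCos (j : ZMod (2 * N + 1)) < zmodCos (i : ZMod (2 * N + 1)) := by
  rw [← Int.cast_natCast j, ← Int.cast_natCast i, zmodCos_intCast, zmodCos_intCast]
  have hpi := Real.pi_pos
  have hij' : (i : ℝ) < j := by exact_mod_cast hij
  have hj' : (j : ℝ) ≤ N := by exact_mod_cast hj
  apply Real.cos_lt_cos_of_nonneg_of_le_pi
  · positivity
  · push_cast
    rw [div_le_iff₀ (by positivity)]
    nlinarith
  · push_cast
    gcongr

lemma det_evenFourierMatrix (N : ℕ) :
    (evenFourierMatrix N).det =
      ∏ i : Fin (N + 1), ∏ j ∈ Ioi i, (2 * zmodCos ((j : ℕ) : ZMod (2 * N + 1)) -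
        2 * zmodCos ((i : ℕ) : ZMod (2 * N + 1))) := by
  rw [← Matrix.det_vandermonde fun i : Fin (N + 1) => 2 * zmodCos ((i : ℕ) : ZMod (2 * N + 1)),
    Matrix.det_eval_matrixOfPolynomials_eq_det_vandermonde _
      (fun j : Fin (N + 1) => if j = 0 then 1 else Polynomial.Chebyshev.C ℝ (j : ℕ))]
  · congr 1
    ext i j
    simp only [evenFourierMatrix, Matrix.of_apply]
    split_ifs with h
    · simp [h]
    · rw [← Nat.cast_mul, ← Int.cast_natCast, ← Int.cast_natCast (i : ℕ), zmodCos_intCast,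
        zmodCos_intCast, Polynomial.Chebyshev.C_two_mul_real_cos]
      congr 2
      push_cast
      ring
  · refine Fin.cases (by simp) fun i => ?_
    simpa using (natDegree_and_monic_chebyshev_C i).1
  · refine Fin.cases (by simp) fun i => ?_
    simpa using (natDegree_and_monic_chebyshev_C i).2

lemma det_evenFourierMatrix_sign (m : ℕ) : 0 < (-1) ^ m * (evenFourierMatrix (2 * m)).det := by
  have hprod : (evenFourierMatrix (2 * m)).det =
      (-1) ^ m * ∏ i : Fin (2 * m + 1), ∏ j ∈ Ioi i,
        (2 * zmodCos ((i : ℕ) : ZMod (2 * (2 * m) + 1)) -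
          2 * zmodCos ((j : ℕ) : ZMod (2 * (2 * m) + 1))) := by
    have hcount : ∑ i : Fin (2 * m + 1), (Ioi i).card = m * (2 * m + 1) := by
      simp only [Fin.card_Ioi]
      rw [Fin.sum_univ_eq_sum_range (fun i => 2 * m + 1 - 1 - i), sum_range_reflect (fun i => i),
        sum_range_id]
      simp only [Nat.add_sub_cancel]
      exact Nat.div_eq_of_eq_mul_left (by norm_num) (by ring)
    have hsign : ((-1 : ℝ)) ^ m = ∏ i : Fin (2 * m + 1), ∏ j ∈ Ioi i, (-1) := by
      simp only [prod_const]
      rw [prod_pow_eq_pow_sum, hcount, mul_comm, pow_mul, pow_succ, pow_mul]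
      simp
    rw [hsign, det_evenFourierMatrix, ← prod_mul_distrib]
    refine prod_congr rfl fun i _ => ?_
    rw [← prod_mul_distrib]
    exact prod_congr rfl fun j _ => by ring
  rw [hprod, ← mul_assoc, ← mul_pow]
  norm_num
  refine prod_pos fun i _ => prod_pos fun j hj => ?_
  have := zmodCos_natCast_strictAnti (N := 2 * m) (Fin.lt_def.1 (mem_Ioi.1 hj)) (by omega)
  linarith

section Gauss

variable {p : ℕ} [Fact p.Prime]

lemma sum_zmod_comp_mul {t : ZMod p} (ht : t ≠ 0) (f : ZMod p → ℝ) :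
    ∑ x, f (t * x) = ∑ x, f x :=
  Equiv.sum_comp (Equiv.mulLeft₀ t ht) f

lemma sum_zmodSin_sq_eq_zero {l : ZMod p} (hl : l ^ 2 = -1) :
    ∑ x : ZMod p, zmodSin (x ^ 2) = 0 := by
  have hl0 : l ≠ 0 := by rintro rfl; simp at hl
  have h := sum_zmod_comp_mul hl0 fun x => zmodSin (x ^ 2)
  simp only [mul_pow, hl, neg_one_mul, zmodSin_neg, sum_neg_distrib] at h
  linarith

lemma sq_sum_zmodCos_sq {l : ZMod p} (hl : l ^ 2 = -1) (hp2 : (2 : ZMod p) ≠ 0) :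
    (∑ x : ZMod p, zmodCos (x ^ 2)) ^ 2 = p := by
  have hs := sum_zmodSin_sq_eq_zero hl
  have h1 : (∑ x : ZMod p, zmodCos (x ^ 2)) ^ 2 =
      ∑ y : ZMod p, ∑ x : ZMod p, zmodCos (x ^ 2 - y ^ 2) := by
    have : ∑ y : ZMod p, ∑ x : ZMod p, zmodCos (x ^ 2 - y ^ 2) =
        (∑ x : ZMod p, zmodCos (x ^ 2)) ^ 2 + (∑ x : ZMod p, zmodSin (x ^ 2)) ^ 2 := by
      simp only [zmodCos_sub, sum_add_distrib, sq (∑ x : ZMod p, _), sum_mul_sum]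
      rw [sum_comm, add_right_inj, sum_comm]
    rw [this, hs]
    ring
  have h2 (y : ZMod p) : ∑ x : ZMod p, zmodCos (x ^ 2 - y ^ 2) =
      ∑ u : ZMod p, zmodCos (u ^ 2 + y * (2 * u)) := by
    rw [← Equiv.sum_comp (Equiv.addRight y)]
    refine sum_congr rfl fun u _ => ?_
    congr 1
    simp only [Equiv.coe_addRight]
    ring
  have h3 (u : ZMod p) : ∑ y : ZMod p, zmodCos (u ^ 2 + y * (2 * u)) =
      if u = 0 then (p : ℝ) else 0 := by
    simp only [zmodCos_add, sum_sub_distrib, ← mul_sum]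
    rw [sum_zmodCos_mul, sum_zmod_eq_zero_of_odd _ (by simp)]
    by_cases hu : u = 0 <;> simp [hu, hp2]
  rw [h1, sum_congr rfl fun y _ => h2 y, sum_comm, sum_congr rfl fun u _ => h3 u]
  simp

end Gauss

/-- The sign of the quadratic Gauss sum for primes congruent to `1` modulo `4`. -/
theorem sum_zmodCos_sq_eq_sqrt {p : ℕ} [Fact p.Prime] (hmod : p % 4 = 1) {l : ZMod p}
    (hl : l ^ 2 = -1) : ∑ x : ZMod p, zmodCos (x ^ 2) = √p := by
  obtain ⟨m, rfl⟩ : ∃ m, p = 2 * (2 * m) + 1 := ⟨p / 4, by omega⟩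
  have hm : m ≠ 0 := by
    rintro rfl
    exact (Fact.out : Nat.Prime (2 * (2 * 0) + 1)).ne_one rfl
  have hp2 : (2 : ZMod (2 * (2 * m) + 1)) ≠ 0 := by
    have : ((2 : ℕ) : ZMod (2 * (2 * m) + 1)) ≠ 0 := by
      rw [Ne, ZMod.natCast_eq_zero_iff]
      exact Nat.not_dvd_of_pos_of_lt (by norm_num) (by omega)
    exact_mod_cast this
  set r : ℝ := √((2 * (2 * m) + 1 : ℕ) : ℝ) with hr
  have hr2 : r ^ 2 = ((2 * (2 * m) + 1 : ℕ) : ℝ) := Real.sq_sqrt (by positivity)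
  have hr0 : 0 < r := Real.sqrt_pos.2 (by positivity)
  obtain ⟨b, htr, hdet⟩ := trace_det_of_mul_self_eq (evenFourierMatrix (2 * m)) r
    (by rw [hr2, evenFourierMatrix_mul_self])
  have hsq := sq_sum_zmodCos_sq hl hp2
  rw [← trace_evenFourierMatrix] at hsq ⊢
  have hpos := det_evenFourierMatrix_sign m
  rw [htr, mul_pow, ← hr2] at hsq
  have hb : (((2 * m + 1 : ℕ) : ℝ) - 2 * b) ^ 2 = 1 :=
    mul_left_cancel₀ (pow_ne_zero 2 hr0.ne') (hsq.trans (mul_one _).symm)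
  rcases sq_eq_sq_iff_eq_or_eq_neg.1 (hb.trans (one_pow 2).symm) with h | h
  · rw [htr, h, mul_one]
  · exfalso
    have hbm : b = m + 1 := by
      have : (b : ℝ) = m + 1 := by
        push_cast at h
        linarith
      exact_mod_cast this
    have hneg : (-1 : ℝ) ^ m * (r ^ (2 * m + 1) * (-1) ^ (m + 1)) = -r ^ (2 * m + 1) := by
      rw [pow_succ (-1 : ℝ) m, mul_left_comm, ← mul_assoc ((-1 : ℝ) ^ m), ← mul_pow]
      norm_num
    rw [hdet, hbm, hneg] at hpos
    linarith [pow_pos hr0 (2 * m + 1)]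

section Eigenvectors

variable {p : ℕ} [Fact p.Prime] {l a : ZMod p}

lemma sum_zmodCos_mul_zmodCos (hmod : p % 4 = 1) (hl : l ^ 2 = -1) (ha : 2 * a = l)
    (b : ZMod p) :
    ∑ x : ZMod p, zmodCos (a * x ^ 2) * zmodCos (b * x) = √p * zmodCos (a * b ^ 2) := by
  have hl0 : l ≠ 0 := by rintro rfl; simp at hl
  have h2 : (2 : ZMod p) ≠ 0 := fun h => hl0 (by rw [← ha, h, zero_mul])
  obtain ⟨t, ht⟩ : ∃ t : ZMod p, a = t ^ 2 := by
    refine ⟨(1 + l) / 2, ?_⟩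
    rw [div_pow, eq_div_iff (pow_ne_zero 2 h2)]
    linear_combination 2 * ha - hl
  have ht0 : t ≠ 0 := by
    rintro rfl
    exact hl0 (by rw [← ha, ht]; ring)
  have hcos : ∑ x : ZMod p, zmodCos (a * (x - l * b) ^ 2) = √p := by
    refine (Equiv.sum_comp (Equiv.subRight (l * b)) fun x => zmodCos (a * x ^ 2)).trans ?_
    rw [ht]
    simp only [← mul_pow]
    rw [sum_zmod_comp_mul ht0 fun x => zmodCos (x ^ 2), sum_zmodCos_sq_eq_sqrt hmod hl]
  have hsin : ∑ x : ZMod p, zmodSin (a * (x - l * b) ^ 2) = 0 := by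
    refine (Equiv.sum_comp (Equiv.subRight (l * b)) fun x => zmodSin (a * x ^ 2)).trans ?_
    rw [ht]
    simp only [← mul_pow]
    rw [sum_zmod_comp_mul ht0 fun x => zmodSin (x ^ 2), sum_zmodSin_sq_eq_zero hl]
  have hodd : ∑ x : ZMod p, zmodSin (a * x ^ 2) * zmodSin (b * x) = 0 :=
    sum_zmod_eq_zero_of_odd _ (by simp)
  have hsquare (x : ZMod p) : a * x ^ 2 + b * x = a * (x - l * b) ^ 2 + a * b ^ 2 := by
    linear_combination (b * x * l) * ha + (b * x - a * b ^ 2) * hl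
  calc ∑ x : ZMod p, zmodCos (a * x ^ 2) * zmodCos (b * x)
      = ∑ x : ZMod p, zmodCos (a * x ^ 2 + b * x) := by
        simp only [zmodCos_add, sum_sub_distrib, hodd, sub_zero]
    _ = √p * zmodCos (a * b ^ 2) := by
        simp only [hsquare, zmodCos_add (a * (_ - l * b) ^ 2), sum_sub_distrib, ← sum_mul, hcos,
          hsin, zero_mul, sub_zero]

/-- The unnormalized eigenvector of the discrete sine transform, as a function on `ZMod p`. -/
noncomputable def sineEigenvector (l a k x : ZMod p) : ℝ :=
  zmodCos (a * x ^ 2) * zmodSin (k * x) + zmodSin (a * (k ^ 2 + x ^ 2)) * zmodSin (l * k * x)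

lemma zmodSin_mul_zmodSin_eq (ha : 2 * a = l) (k x : ZMod p) :
    zmodSin (a * (k ^ 2 + x ^ 2)) * zmodSin (l * k * x) =
      (zmodCos (a * (x - k) ^ 2) - zmodCos (a * (x + k) ^ 2)) / 2 := by
  have h1 : a * (x - k) ^ 2 = a * (k ^ 2 + x ^ 2) - l * k * x := by
    linear_combination (-k * x) * ha
  have h2 : a * (x + k) ^ 2 = a * (k ^ 2 + x ^ 2) + l * k * x := by
    linear_combination (k * x) * ha
  rw [h1, h2, zmodCos_sub, zmodCos_add]
  ring

lemma sum_zmodSin_mul_zmodCos_shift (hmod : p % 4 = 1) (hl : l ^ 2 = -1) (ha : 2 * a = l)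
    (k x : ZMod p) :
    ∑ y : ZMod p, zmodSin (x * y) * zmodCos (a * (y - k) ^ 2) =
      √p * (zmodCos (a * x ^ 2) * zmodSin (k * x)) := by
  have hodd : ∑ y : ZMod p, zmodCos (a * y ^ 2) * zmodSin (x * y) = 0 :=
    sum_zmod_eq_zero_of_odd _ (by simp)
  rw [← Equiv.sum_comp (Equiv.addRight k)]
  calc ∑ y : ZMod p, zmodSin (x * (y + k)) * zmodCos (a * (y + k - k) ^ 2)
      = ∑ y : ZMod p, (zmodCos (k * x) * (zmodCos (a * y ^ 2) * zmodSin (x * y)) +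
          zmodSin (k * x) * (zmodCos (a * y ^ 2) * zmodCos (x * y))) := by
        refine sum_congr rfl fun y _ => ?_
        rw [add_sub_cancel_right, mul_add, zmodSin_add, mul_comm x k]
        ring
    _ = √p * (zmodCos (a * x ^ 2) * zmodSin (k * x)) := by
        rw [sum_add_distrib, ← mul_sum, ← mul_sum, hodd, sum_zmodCos_mul_zmodCos hmod hl ha]
        ring

lemma sum_zmodSin_mul_sineEigenvector (hmod : p % 4 = 1) (hl : l ^ 2 = -1) (ha : 2 * a = l)
    (k x : ZMod p) :
    ∑ y : ZMod p, zmodSin (x * y) * sineEigenvector l a k y = √p * sineEigenvector l a k x := by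
  have hminus := sum_zmodSin_mul_zmodCos_shift hmod hl ha k x
  have hplus := sum_zmodSin_mul_zmodCos_shift hmod hl ha (-k) x
  have hcminus := sum_zmodCos_mul_zmodCos hmod hl ha (x - k)
  have hcplus := sum_zmodCos_mul_zmodCos hmod hl ha (x + k)
  simp only [sub_neg_eq_add, neg_mul, zmodSin_neg] at hplus
  have hsplit : ∑ y : ZMod p, zmodSin (x * y) * sineEigenvector l a k y =
      (∑ y : ZMod p, zmodCos (a * y ^ 2) * zmodCos ((x - k) * y) -
        ∑ y : ZMod p, zmodCos (a * y ^ 2) * zmodCos ((x + k) * y)) / 2 +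
      (∑ y : ZMod p, zmodSin (x * y) * zmodCos (a * (y - k) ^ 2) -
        ∑ y : ZMod p, zmodSin (x * y) * zmodCos (a * (y + k) ^ 2)) / 2 := by
    rw [← sum_sub_distrib, ← sum_sub_distrib, sum_div, sum_div, ← sum_add_distrib]
    refine sum_congr rfl fun y _ => ?_
    rw [sineEigenvector, zmodSin_mul_zmodSin_eq ha, sub_mul, add_mul x, zmodCos_sub, zmodCos_add]
    ring
  rw [hsplit, hminus, hplus, hcminus, hcplus, sineEigenvector, zmodSin_mul_zmodSin_eq ha]
  ring

lemma sum_zmodSin_mul_sineEigenvector_comp_mul (hmod : p % 4 = 1) (hl : l ^ 2 = -1)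
    (ha : 2 * a = l) (k x : ZMod p) :
    ∑ y : ZMod p, zmodSin (x * y) * sineEigenvector l a k (l * y) =
      -(√p * sineEigenvector l a k (l * x)) := by
  have hl0 : l ≠ 0 := by rintro rfl; simp at hl
  rw [← sum_zmodSin_mul_sineEigenvector hmod hl ha,
    ← sum_zmod_comp_mul hl0 fun y => zmodSin (l * x * y) * _, ← sum_neg_distrib]
  refine sum_congr rfl fun y _ => ?_
  have : l * x * (l * y) = -(x * y) := by linear_combination (x * y) * hl
  rw [this, zmodSin_neg]
  ring

end Eigenvectors

lemma sum_fin_pred_eq_sum_zmod {p : ℕ} [NeZero p] (f : ZMod p → ℝ) (hf : f 0 = 0) :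
    ∑ i : Fin (p - 1), f (((i : ℕ) : ZMod p) + 1) = ∑ x, f x := by
  rw [sum_zmod_eq_sum_range,
    Fin.sum_univ_eq_sum_range (fun i => f (((i : ℕ) : ZMod p) + 1)) (p - 1)]
  conv_rhs => rw [show range p = range (p - 1 + 1) by rw [Nat.sub_add_cancel NeZero.one_le]]
  rw [sum_range_succ']
  simp [hf]

theorem stmt_15 (p : ℕ) (hp : p.Prime) (hmod : p % 4 = 1)
    (lam c : ℤ) (hlam : (lam ^ 2) % (p : ℤ) = (-1) % (p : ℤ))
    (hc : (2 * c) % (p : ℤ) = 1 % (p : ℤ))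
    (Φp : ℤ → ℤ → ℝ)
    (hΦp : ∀ k x : ℤ, Φp k x = (1 / Real.sqrt p) *
      (Real.cos (2 * Real.pi * (lam * c) * x ^ 2 / p) * Real.sin (2 * Real.pi * k * x / p) +
       Real.sin (2 * Real.pi * (lam * c) * (k ^ 2 + x ^ 2) / p) *
         Real.sin (2 * Real.pi * (lam * k) * x / p)))
    (S : Matrix (Fin (p - 1)) (Fin (p - 1)) ℝ)
    (hS : ∀ x y : Fin (p - 1), S x y =
      (1 / Real.sqrt p) * Real.sin (2 * Real.pi * ((x : ℕ) + 1) * ((y : ℕ) + 1) / p))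
    (k h : ℤ) (hk : ¬ (p : ℤ) ∣ k) (hh : h % (p : ℤ) = (lam * k) % (p : ℤ))
    (Φplus Φminus : Fin (p - 1) → ℝ)
    (hplus : ∀ x : Fin (p - 1), Φplus x = Φp k ((x : ℕ) + 1))
    (hminus : ∀ x : Fin (p - 1), Φminus x = Φp k (lam * ((x : ℕ) + 1))) :
    S.mulVec Φplus = Φplus ∧ S.mulVec Φminus = -Φminus := by
  have : Fact p.Prime := ⟨hp⟩
  have hl : (lam : ZMod p) ^ 2 = -1 := by
    exact_mod_cast (ZMod.intCast_eq_intCast_iff' (lam ^ 2) (-1) p).2 hlam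
  have hc' : (2 : ZMod p) * c = 1 := by
    exact_mod_cast (ZMod.intCast_eq_intCast_iff' (2 * c) 1 p).2 hc
  have ha : 2 * ((lam : ZMod p) * c) = lam := by linear_combination (lam : ZMod p) * hc'
  have hsqrt : √(p : ℝ) ≠ 0 := (Real.sqrt_pos.2 (by exact_mod_cast hp.pos)).ne'
  have hΦ (x : ℤ) : Φp k x = 1 / √p * sineEigenvector (lam : ZMod p) (lam * c) k x := by
    have h1 := zmodCos_intCast (p := p) (lam * c * x ^ 2)
    have h2 := zmodSin_intCast (p := p) (k * x)
    have h3 := zmodSin_intCast (p := p) (lam * c * (k ^ 2 + x ^ 2))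
    have h4 := zmodSin_intCast (p := p) (lam * k * x)
    push_cast at h1 h2 h3 h4
    rw [hΦp, sineEigenvector, h1, h2, h3, h4]
    simp only [mul_assoc]
  have hS' (x y : Fin (p - 1)) :
      S x y = 1 / √p * zmodSin ((((x : ℕ) : ZMod p) + 1) * (((y : ℕ) : ZMod p) + 1)) := by
    have h := zmodSin_intCast (p := p) (((x : ℕ) + 1) * ((y : ℕ) + 1))
    push_cast at h
    rw [hS, h]
    simp only [mul_assoc]
  have hplus' (x : Fin (p - 1)) :
      Φplus x = 1 / √p * sineEigenvector (lam : ZMod p) (lam * c) k (((x : ℕ) : ZMod p) + 1) := by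
    rw [hplus, hΦ]
    push_cast
    rfl
  have hminus' (x : Fin (p - 1)) : Φminus x =
      1 / √p * sineEigenvector (lam : ZMod p) (lam * c) k (lam * (((x : ℕ) : ZMod p) + 1)) := by
    rw [hminus, hΦ]
    push_cast
    rfl
  constructor
  · ext x
    have h := sum_zmodSin_mul_sineEigenvector hmod hl ha (k : ZMod p) (((x : ℕ) : ZMod p) + 1)
    rw [← sum_fin_pred_eq_sum_zmod _ (by simp)] at h
    have hsum : (S *ᵥ Φplus) x = 1 / √p * (1 / √p) * ∑ y : Fin (p - 1),
        zmodSin ((((x : ℕ) : ZMod p) + 1) * (((y : ℕ) : ZMod p) + 1)) *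
          sineEigenvector (lam : ZMod p) (lam * c) k (((y : ℕ) : ZMod p) + 1) := by
      rw [mulVec, dotProduct, mul_sum]
      exact sum_congr rfl fun y _ => by rw [hS', hplus']; ring
    rw [hsum, h, hplus']
    field_simp
  · ext x
    have h := sum_zmodSin_mul_sineEigenvector_comp_mul hmod hl ha (k : ZMod p)
      (((x : ℕ) : ZMod p) + 1)
    rw [← sum_fin_pred_eq_sum_zmod _ (by simp)] at h
    have hsum : (S *ᵥ Φminus) x = 1 / √p * (1 / √p) * ∑ y : Fin (p - 1),
        zmodSin ((((x : ℕ) : ZMod p) + 1) * (((y : ℕ) : ZMod p) + 1)) *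
          sineEigenvector (lam : ZMod p) (lam * c) k (lam * (((y : ℕ) : ZMod p) + 1)) := by
      rw [mulVec, dotProduct, mul_sum]
      exact sum_congr rfl fun y _ => by rw [hS', hminus']; ring
    rw [hsum, h, Pi.neg_apply, hminus']
    field_simp
end
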